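/- Let a ∈ C_c^∞(T*𝕋^d) with Fourier expansion a(x,ξ) = Σ_{k∈ℤ^d} a_k(ξ)ψ_k(x), and let φ ∈ S(ℝ). Then for every resonant direction ω and every ξ ∈ I_ω the operator k_{a,φ}(ω,ξ) is Hilbert–Schmidt on L²(γ_ω), and Σ_{ω∈𝕎} ‖k_{a,φ}(ω,ξ)‖²_{HS} ≤ (2π)^{-d} (Σ_{n∈ℤ} |φ̂(n/2)|²) · ‖a(·,ξ) − a_0(ξ)ψ_0‖²_{L²(𝕋^d)}. -/

import Mathlib

/-!
Setting (F. Macià, "High-frequency propagation for the Schrödinger equation on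
the torus").

The flat torus `𝕋^d = ℝ^d/(2πℤ)^d` is modelled as `Fin d → AddCircle (2π)`; an
element `u ∈ L²(𝕋^d)` is represented by its sequence of Fourier coefficients
`û : ℤ^d → ℂ` (with respect to the orthonormal basis `ψ_k = (2π)^{-d/2} e^{ik·x}`),
and operators on `L²(γ_ω)` by their kernels (matrices) in the orthonormal basis
`φ_m^ω(s) = e^{ims/|p_ω|}/√(2π|p_ω|)`, `m ∈ ℤ`.
-/

noncomputable section

open MeasureTheory Filter
open scoped BigOperators ComplexConjugate Topology ENNReal

namespace TorusSchrodinger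

instance fact_two_pi_pos : Fact (0 < 2 * Real.pi) := ⟨by positivity⟩

/-- The lattice `ℤ^d` of Fourier frequencies. -/
abbrev Zd (d : ℕ) := Fin d → ℤ
/-- Euclidean space `ℝ^d` (the fibre of `T^*𝕋^d`). -/
abbrev Rd (d : ℕ) := Fin d → ℝ
/-- The standard flat torus `𝕋^d = ℝ^d/(2πℤ)^d`. -/
abbrev Td (d : ℕ) := Fin d → AddCircle (2 * Real.pi)
/-- The phase space `T^*𝕋^d ≅ 𝕋^d × ℝ^d`. -/
abbrev Phase (d : ℕ) := Td d × Rd d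

variable {d : ℕ}

/-- Inclusion of the lattice `ℤ^d` into `ℝ^d`. -/
def toRd (k : Zd d) : Rd d := fun i => (k i : ℝ)

/-- The canonical projection `ℝ^d → 𝕋^d`. -/
def torusProj (x : Rd d) : Td d := fun i => (x i : AddCircle (2 * Real.pi))

/-- The character `e^{i k·x}` on the torus `𝕋^d`. -/
def char (k : Zd d) (x : Td d) : ℂ := ∏ i, fourier (k i) (x i)

/-- Euclidean inner product of two lattice vectors. -/
def dotZ (k l : Zd d) : ℤ := ∑ i, k i * l i

/-- Euclidean inner product of a lattice vector with a vector of `ℝ^d`. -/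
def dotR (k : Zd d) (ξ : Rd d) : ℝ := ∑ i, (k i : ℝ) * ξ i

/-- The set `Ω` of resonant frequencies in `ℝ^d`. -/
def Omega (d : ℕ) : Set (Rd d) := {ξ | ∃ k : Zd d, k ≠ 0 ∧ dotR k ξ = 0}

/-- A resonant direction `ω ∈ 𝕎`, encoded by its primitive lattice vector `p_ω`:
the nonzero components of `p_ω` are coprime and its first nonzero component is
positive. -/
structure ResonantDir (d : ℕ) where
  p : Zd d
  ne : p ≠ 0
  gcd_one : Finset.univ.gcd (fun i => (p i).natAbs) = 1
  first_pos : ∀ i, (∀ j, j < i → p j = 0) → 0 ≤ p i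

/-- `|p_ω|²`, as an integer. -/
def ResonantDir.M (ω : ResonantDir d) : ℤ := dotZ ω.p ω.p

/-- Orthogonal projection of a lattice point onto the hyperplane `I_ω`. -/
def projPerp (ω : ResonantDir d) (k : Zd d) : Rd d :=
  toRd k - (((dotZ k ω.p : ℝ) / (ω.M : ℝ)) • toRd ω.p)

/-- The set `ω_n^⊥ ⊆ I_ω`: those `r` in the hyperplane `I_ω` with
`(n/|p_ω|)ν_ω + r ∈ ℤ^d` (note `(n/|p_ω|)ν_ω = (n/|p_ω|²) p_ω`). -/
def perpSet (ω : ResonantDir d) (n : ℤ) : Set (Rd d) :=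
  {r | dotR ω.p r = 0 ∧ ∃ k : Zd d, toRd k = ((n : ℝ) / (ω.M : ℝ)) • toRd ω.p + r}

/-! Kernels: operators on `L²(γ_ω)` are represented by their matrix in the
orthonormal basis `(φ_m^ω)_{m ∈ ℤ}`. -/

/-- Kernels of Hermitian operators. -/
def KerHermitian (K : ℤ → ℤ → ℂ) : Prop := ∀ m n, K n m = conj (K m n)

/-- Positive (semidefinite) kernels: the quadratic form is nonnegative on all
finitely supported vectors. -/
def KerPos (K : ℤ → ℤ → ℂ) : Prop :=
  ∀ v : ℤ →₀ ℂ, 0 ≤ (∑ m ∈ v.support, ∑ n ∈ v.support, conj (v m) * K m n * v n).re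

/-- Hilbert–Schmidt kernels. -/
def IsHSKer (K : ℤ → ℤ → ℂ) : Prop := Summable fun q : ℤ × ℤ => ‖K q.1 q.2‖ ^ 2

/-- Trace class kernels: products of two Hilbert–Schmidt kernels. -/
def IsTraceClassKer (K : ℤ → ℤ → ℂ) : Prop :=
  ∃ A B : ℤ → ℤ → ℂ, IsHSKer A ∧ IsHSKer B ∧ ∀ m n, K m n = ∑' j : ℤ, A m j * B j n

/-- Kernels of operators of operator norm at most 1. -/
def KerContraction (C : ℤ → ℤ → ℂ) : Prop :=
  ∀ v : ℤ →₀ ℂ, ∑' m : ℤ, ‖∑ n ∈ v.support, C m n * v n‖ ^ 2 ≤ ∑ n ∈ v.support, ‖v n‖ ^ 2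

/-- The trace norm `tr|K|` of a kernel, via duality with contractions. -/
def traceNorm (K : ℤ → ℤ → ℂ) : ℝ :=
  ⨆ C : {C : ℤ → ℤ → ℂ // KerContraction C}, ‖∑' q : ℤ × ℤ, K q.1 q.2 * C.1 q.2 q.1‖

/-- Truncation of a kernel to the square `[-N,N]²`. -/
def kerTrunc (N : ℕ) (C : ℤ → ℤ → ℂ) : ℤ → ℤ → ℂ := fun m n =>
  if m.natAbs ≤ N ∧ n.natAbs ≤ N then C m n else 0

/-- The operator norm of a kernel. -/
def kerOpNorm (C : ℤ → ℤ → ℂ) : ℝ :=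
  ⨆ v : {v : ℤ →₀ ℂ // ∑ n ∈ v.support, ‖v n‖ ^ 2 ≤ 1},
    Real.sqrt (∑' m : ℤ, ‖∑ n ∈ v.1.support, C m n * v.1 n‖ ^ 2)

/-- Kernels of compact operators: operator-norm limits of their finite truncations. -/
def KerCompact (C : ℤ → ℤ → ℂ) : Prop :=
  Tendsto (fun N : ℕ => kerOpNorm fun m n => C m n - kerTrunc N C m n) atTop (𝓝 0)

/-! Wigner distributions. -/

/-- Fourier coefficients of the solution at time `t` of the Schrödinger equation
`i∂_t u + (1/2)Δu = 0` on `𝕋^d` in terms of those of the initial datum. -/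
def schrodinger (t : ℝ) (u : Zd d → ℂ) : Zd d → ℂ := fun k =>
  Complex.exp (-Complex.I * (t : ℂ) * (((∑ i, ((k i : ℝ)) ^ 2 : ℝ)) : ℂ) / 2) * u k

/-- The pairing `⟨w_u^h, a⟩` of the Wigner distribution at scale `h` of (the
function with Fourier coefficients) `u` with a symbol `a` on `T^*𝕋^d`. -/
def wignerPair (u : Zd d → ℂ) (h : ℝ) (a : Phase d → ℂ) : ℂ :=
  (((2 * Real.pi) ^ d : ℝ) : ℂ)⁻¹ *
    ∑' q : Zd d × Zd d,
      u q.1 * conj (u q.2) *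
        ∫ x : Td d, a (x, (h / 2) • (toRd q.1 + toRd q.2)) * char (q.1 - q.2) x

/-- Test symbols `a ∈ C_c^∞(T^*𝕋^d)`. -/
def IsSymbol (a : Phase d → ℂ) : Prop :=
  Continuous a ∧ HasCompactSupport a ∧
    ContDiff ℝ (⊤ : ℕ∞) fun q : Rd d × Rd d => a (torusProj q.1, q.2)

/-- A sequence of data `(u_h)` in `L²(𝕋^d)` (given by their Fourier coefficients),
bounded in `L²`, with scales `h → 0⁺`. -/
structure WignerData (d : ℕ) where
  h : ℕ → ℝ
  u : ℕ → Zd d → ℂ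
  h_pos : ∀ n, 0 < h n
  h_lim : Tendsto h atTop (𝓝 0)
  bounded : ∃ C : ℝ, ∀ n, ∑' k, ‖u n k‖ ^ 2 ≤ C

/-- Extraction of a subsequence. -/
def WignerData.sub (D : WignerData d) (σ : ℕ → ℕ) (hσ : StrictMono σ) : WignerData d where
  h := D.h ∘ σ
  u := D.u ∘ σ
  h_pos n := D.h_pos (σ n)
  h_lim := D.h_lim.comp hσ.tendsto_atTop
  bounded := D.bounded.imp fun _C hC n => hC (σ n)

/-- The `h`-oscillation property:
`limsup_{h→0⁺} ∑_{|k| > R/h} |û_h(k)|² → 0` as `R → ∞`. -/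
def HOsc (D : WignerData d) : Prop :=
  Tendsto (fun R : ℝ =>
      limsup (fun n =>
        ∑' k : {k : Zd d // R ^ 2 < (∑ i, ((k i : ℝ)) ^ 2) * (D.h n) ^ 2}, ‖D.u n k.1‖ ^ 2)
        atTop)
    atTop (𝓝 0)

/-- `μ0` is the semiclassical (Wigner) measure of the sequence `(u_h)`:
`w_{u_h}^h(0,·) ⇀ μ0`. -/
def IsSemiclassical (D : WignerData d) (μ0 : Measure (Phase d)) : Prop :=
  ∀ a : Phase d → ℂ, IsSymbol a →
    Tendsto (fun n => wignerPair (D.u n) (D.h n) a) atTop (𝓝 (∫ q, a q ∂μ0))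

/-- `μ` is a time-averaged Wigner limit of the Schrödinger evolution of `(u_h)`. -/
def IsTimeAvgLimit (D : WignerData d) (μ : ℝ → Measure (Phase d)) : Prop :=
  ∀ a : Phase d → ℂ, IsSymbol a → ∀ φ : ℝ → ℂ, Integrable φ →
    Tendsto (fun n => ∫ t : ℝ, φ t * wignerPair (schrodinger t (D.u n)) (D.h n) a) atTop
      (𝓝 (∫ t : ℝ, φ t * ∫ q, a q ∂(μ t)))

/-! The resonant Wigner distribution and resonant Wigner measures. -/

/-- The pairing `tr ∫ b(ξ) R_u^h(ω, dξ)` of the resonant Wigner distribution of `u`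
at scale `h` in the resonant direction `ω` with an operator-valued test function
`b` (given by its kernel in the basis `(φ_m^ω)`).  The parametrisation
`k = (m/|p_ω|)ν_ω + r`, `j = (n/|p_ω|)ν_ω + r` (so `m = k·p_ω`, `n = j·p_ω`,
`r = projPerp ω k`) of pairs of frequencies with `k - j ∈ ℤ p_ω` is used. -/
def resPair (u : Zd d → ℂ) (h : ℝ) (ω : ResonantDir d) (b : Rd d → ℤ → ℤ → ℂ) : ℂ :=
  ∑' q : {q : Zd d × Zd d // ∃ l : ℤ, q.1 - q.2 = l • ω.p},
    u q.1.1 * conj (u q.1.2) * b (h • projPerp ω q.1.1) (dotZ q.1.2 ω.p) (dotZ q.1.1 ω.p)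

/-- A positive finite measure on `ℝ^d` with values in the trace-class operators on
`L²(γ_ω)`, represented (via the Radon–Nikodym theorem for operator-valued
measures) by its scalar trace measure `trMeas` and a measurable field `dens` of
positive Hermitian density matrices of unit trace (in the basis `(φ_m^ω)`). -/
structure OpMeasure (d : ℕ) where
  trMeas : Measure (Rd d)
  finite : IsFiniteMeasure trMeas
  dens : Rd d → ℤ → ℤ → ℂ
  meas : ∀ m n, Measurable fun ξ => dens ξ m n
  herm : ∀ ξ m n, dens ξ n m = conj (dens ξ m n)
  pos : ∀ ξ, KerPos (dens ξ)
  normalized : ∀ ξ, HasSum (fun m : ℤ => dens ξ m m) 1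

/-- The pairing `tr ∫ b(ξ) μ(dξ)` of an operator-valued measure with an
operator-valued test function. -/
def OpMeasure.trPair (M : OpMeasure d) (b : Rd d → ℤ → ℤ → ℂ) : ℂ :=
  ∫ ξ, (∑' q : ℤ × ℤ, b ξ q.2 q.1 * M.dens ξ q.1 q.2) ∂M.trMeas

/-- Test sections `b ∈ C_c(I_ω; K(L²(γ_ω)))`: continuous, compactly supported,
compact-operator-valued. -/
def IsOpTestField (b : Rd d → ℤ → ℤ → ℂ) : Prop :=
  Continuous b ∧ HasCompactSupport b ∧ ∀ ξ : Rd d, KerCompact (b ξ)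

/-- `μR` is a resonant Wigner measure of the sequence `(u_h)`: for every resonant
direction `ω` it is a positive trace-class-operator-valued measure concentrated
on `I_ω` whose matrix entries `(m,n)` vanish unless `m ≡ n (mod |p_ω|²)`, and
`tr ∫ b dR_{u_h}^h(ω,·) → tr ∫ b dμR(ω,·)` for all test sections `b`. -/
def IsResonantWignerMeasure (D : WignerData d) (μR : ResonantDir d → OpMeasure d) : Prop :=
  ∀ ω : ResonantDir d,
    (μR ω).trMeas {ξ | dotR ω.p ξ ≠ 0} = 0 ∧
    (∀ (ξ : Rd d) (m n : ℤ), ¬ (ω.M ∣ (m - n)) → (μR ω).dens ξ m n = 0) ∧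
    ∀ b : Rd d → ℤ → ℤ → ℂ, IsOpTestField b →
      Tendsto (fun n => resPair (D.u n) (D.h n) ω b) atTop (𝓝 ((μR ω).trPair b))

/-- The density matrix of `μ_R^t(ω,·) = e^{it∂_ω²/2} μ_R⁰(ω,·) e^{-it∂_ω²/2}`, the
solution of the density-matrix Schrödinger equation
`i∂_t μ_R^t = [-(1/2)∂_ω², μ_R^t]` on `γ_ω` with initial datum `μ_R⁰`. -/
def densT (M : OpMeasure d) (ω : ResonantDir d) (t : ℝ) (ξ : Rd d) (m n : ℤ) : ℂ :=
  Complex.exp (-Complex.I * (t : ℂ) * ((((m ^ 2 - n ^ 2 : ℤ) : ℝ) / (2 * (ω.M : ℝ)) : ℝ) : ℂ)) *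
    M.dens ξ m n

/-- The geodesic flow `φ_s(x,ξ) = (x + sξ, ξ)` on `T^*𝕋^d`. -/
def geoFlow (s : ℝ) (q : Phase d) : Phase d := (q.1 + torusProj (s • q.2), q.2)

/-- `g` is (a density of) the signed measure
`ρ_ω^t = E_ω(ρ̃_ω^t(·,ξ) − (2π|p_ω|)⁻¹ (tr μ_R^t(ω,ξ)) ds)` on `𝕋^d × I_ω`, where
`ρ̃_ω^t` is the trace density of `μ_R^t(ω,·)` and `E_ω` the extension operator:
`g` is characterised by its Fourier coefficients in `x`, which are supported on
the frequencies `l p_ω`, `l ≠ 0`, and are given there by the corresponding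
traces `∑_{m-n=l|p_ω|²} μ_R^t(ω,·)(m,n)` of the propagated measure. -/
def IsRhoDensity (M : OpMeasure d) (ω : ResonantDir d) (t : ℝ) (g : Phase d → ℝ) : Prop :=
  Integrable g ((volume : Measure (Td d)).prod M.trMeas) ∧
  (∀ l : ℤ, l ≠ 0 → ∀ φ : Rd d → ℂ, Continuous φ → HasCompactSupport φ →
    ∫ q : Phase d, char (l • ω.p) q.1 * φ q.2 * ((g q : ℝ) : ℂ)
        ∂((volume : Measure (Td d)).prod M.trMeas)
      = ∫ ξ : Rd d, φ ξ * ∑' n : ℤ, densT M ω t ξ (n - l * ω.M) n ∂M.trMeas) ∧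
  (∀ k : Zd d, (¬ ∃ l : ℤ, l ≠ 0 ∧ k = l • ω.p) → ∀ φ : Rd d → ℂ, Continuous φ →
    HasCompactSupport φ →
    ∫ q : Phase d, char k q.1 * φ q.2 * ((g q : ℝ) : ℂ)
        ∂((volume : Measure (Td d)).prod M.trMeas) = 0)

/-- The signed measure `ρ_ω^t` on `T^*𝕋^d` associated to a density `g` (with
respect to `dx ⊗ tr μ_R(ω,·)`). -/
def rhoMeas (M : OpMeasure d) (g : Phase d → ℝ) : SignedMeasure (Phase d) :=
  ((volume : Measure (Td d)).prod M.trMeas).withDensityᵥ g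

/-! Symbols, `k_{a,φ}`, `K_b`, position densities, wave packets. -/

/-- The `k`-th Fourier coefficient in `x` of a symbol `a(x,ξ)` on `T^*𝕋^d`:
`a_k(ξ) = ∫_{𝕋^d} a(x,ξ) conj(ψ_k(x)) dx`. -/
def symbCoeff (a : Phase d → ℂ) (k : Zd d) (ξ : Rd d) : ℂ :=
  ((Real.sqrt ((2 * Real.pi) ^ d) : ℝ) : ℂ)⁻¹ * ∫ x : Td d, a (x, ξ) * conj (char k x)

/-- The Fourier transform `φ̂(s) = ∫ φ(t) e^{-its} dt`. -/
def phiHat (φ : ℝ → ℂ) (s : ℝ) : ℂ :=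
  ∫ t : ℝ, φ t * Complex.exp (-Complex.I * (t : ℂ) * (s : ℂ))

/-- The kernel (in the basis `(φ_m^ω)`) of the operator `k_{a,φ}(ω,ξ)` on
`L²(γ_ω)`. -/
def kerKaphi (a : Phase d → ℂ) (φ : ℝ → ℂ) (ω : ResonantDir d) (ξ : Rd d) (m n : ℤ) : ℂ :=
  if m ≠ n ∧ ω.M ∣ (m - n) then
    ((Real.sqrt ((2 * Real.pi) ^ d) : ℝ) : ℂ)⁻¹ *
      phiHat φ (((n ^ 2 - m ^ 2 : ℤ) : ℝ) / (2 * (ω.M : ℝ))) *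
      symbCoeff a (((m - n) / ω.M) • ω.p) ξ
  else 0

/-- The kernel (in the basis `(φ_m^ω)`) of the operator
`K_b = ∫_{I_ω} b(ξ) R_u^h(ω,dξ)` on `L²(γ_ω)`: for `m ≡ n (mod |p_ω|²)`,
`k_b(m,n) = ∑_{r ∈ ω_c^⊥} b(hr) û((m/|p_ω|)ν_ω+r) conj(û((n/|p_ω|)ν_ω+r))`, using
the parametrisation of `ω_m^⊥` by `{k ∈ ℤ^d : k·p_ω = m}`. -/
def kerKb (u : Zd d → ℂ) (h : ℝ) (ω : ResonantDir d) (b : Rd d → ℂ) (m n : ℤ) : ℂ :=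
  if ω.M ∣ (n - m) then
    ∑' k : {k : Zd d // dotZ k ω.p = m},
      b (h • projPerp ω k.1) * u k.1 * conj (u (k.1 + ((n - m) / ω.M) • ω.p))
  else 0

/-- The pairing `∫_{𝕋^d} m(x) |u(x)|² dx` of a position density with a test
function `m`. -/
def posDenPair (u : Zd d → ℂ) (m : Td d → ℂ) : ℂ :=
  (((2 * Real.pi) ^ d : ℝ) : ℂ)⁻¹ *
    ∑' q : Zd d × Zd d, u q.1 * conj (u q.2) * ∫ x : Td d, m x * char (q.1 - q.2) x

/-- Fourier coefficients of the `2πℤ^d`-periodisation of the wave packet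
`h^{-d/4} ρ((x-x₀)/√h) e^{iξ₀·x/h}` (for `ρ` supported in `(-π,π)^d`). -/
def wavePacket (ρ : Rd d → ℂ) (x₀ ξ₀ : Rd d) (h : ℝ) (k : Zd d) : ℂ :=
  ((Real.sqrt ((2 * Real.pi) ^ d) : ℝ) : ℂ)⁻¹ *
    ∫ x : Rd d, ((h ^ (-(d : ℝ) / 4) : ℝ) : ℂ) * ρ (fun i => (x i - x₀ i) / Real.sqrt h) *
      Complex.exp (Complex.I * ((∑ i, (ξ₀ i / h - (k i : ℝ)) * x i : ℝ) : ℂ))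

/-- Fourier coefficients of the `2πℤ^d`-periodisation of `ρ(x) e^{iξ₀·x/h}` (for
`ρ` supported in `(-π,π)^d`). -/
def oscData (ρ : Rd d → ℂ) (ξ₀ : Rd d) (h : ℝ) (k : Zd d) : ℂ :=
  ((Real.sqrt ((2 * Real.pi) ^ d) : ℝ) : ℂ)⁻¹ *
    ∫ x : Rd d, ρ x * Complex.exp (Complex.I * ((∑ i, (ξ₀ i / h - (k i : ℝ)) * x i : ℝ) : ℂ))

/-- The solution `e^{itΔ/2} ρ_per` on `𝕋^d`, where `ρ_per` is the
`2πℤ^d`-periodisation of `ρ`. -/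
def evolvedPer (ρ : Rd d → ℂ) (t : ℝ) (x : Td d) : ℂ :=
  ((Real.sqrt ((2 * Real.pi) ^ d) : ℝ) : ℂ)⁻¹ *
    ∑' k : Zd d,
      Complex.exp (-Complex.I * (t : ℂ) * ((∑ i, ((k i : ℝ)) ^ 2 : ℝ) : ℂ) / 2) *
        oscData ρ 0 1 k * char k x

/-- Euclidean norm on `ℝ^d`. -/
def euclNorm (ξ : Rd d) : ℝ := Real.sqrt (∑ i, ξ i ^ 2)

/-- The length `L` of the periodic geodesic of `𝕋^d` issued from `(x, ξ₀)`: the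
least `l > 0` such that `l·ξ₀/|ξ₀| ∈ 2πℤ^d`. -/
def geoLen (ξ₀ : Rd d) : ℝ :=
  sInf {l : ℝ | 0 < l ∧ ∃ k : Zd d, (l / euclNorm ξ₀) • ξ₀ = (2 * Real.pi) • toRd k}

/-- The average `⟨f⟩_{ξ₀}(x) = (|ξ₀|/L)∫_0^{L/|ξ₀|} f(x+sξ₀) ds` along the closed
geodesic in the direction `ξ₀`. -/
def geoAvg (f : Td d → ℝ) (ξ₀ : Rd d) (x : Td d) : ℝ :=
  euclNorm ξ₀ / geoLen ξ₀ *
    ∫ s in Set.Ioc (0 : ℝ) (geoLen ξ₀ / euclNorm ξ₀), f (x + torusProj (s • ξ₀))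

theorem phiHat_eq_fourier (φ : ℝ → ℂ) (s : ℝ) :
    phiHat φ s = FourierTransform.fourier φ (s / (2 * Real.pi)) := by
  rw [Real.fourier_real_eq_integral_exp_smul, phiHat]
  refine integral_congr_ae (Eventually.of_forall fun t => ?_)
  have h : (-Complex.I * (t : ℂ) * (s : ℂ)) =
      ((-2 * Real.pi * t * (s / (2 * Real.pi)) : ℝ) : ℂ) * Complex.I := by
    have : -2 * Real.pi * t * (s / (2 * Real.pi)) = -(t * s) := by
      field_simp
    rw [this]
    push_cast
    ring
  simp only [h, smul_eq_mul]
  ring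

/-- The samples of `φ̂` at the half-integers are square summable. -/
theorem summable_phiHat_half (φ : SchwartzMap ℝ ℂ) :
    Summable fun n : ℤ => ‖phiHat (fun t => φ t) ((n : ℝ) / 2)‖ ^ 2 := by
  obtain ⟨C, -, hC⟩ := (FourierTransform.fourier φ).decay 1 0
  have hs : Summable fun n : ℤ => (4 * Real.pi * C) ^ 2 * (1 / (n : ℝ) ^ 2) :=
    (Real.summable_one_div_int_pow.mpr one_lt_two).mul_left _
  refine hs.of_norm_bounded_eventually ?_
  have h0 : ∀ᶠ n : ℤ in cofinite, n ≠ 0 :=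
    (Set.finite_singleton (0 : ℤ)).compl_mem_cofinite
  filter_upwards [h0] with n hn
  have hn' : (0 : ℝ) < |(n : ℝ)| := by positivity
  have hb := hC ((n : ℝ) / 2 / (2 * Real.pi))
  rw [norm_iteratedFDeriv_zero, SchwartzMap.fourier_coe, ← phiHat_eq_fourier, pow_one,
    Real.norm_eq_abs, abs_div, abs_div, abs_of_pos (show (0 : ℝ) < 2 by norm_num),
    abs_of_pos Real.two_pi_pos] at hb
  have hb' : ‖phiHat (fun t => φ t) ((n : ℝ) / 2)‖ ≤ 4 * Real.pi * C / |(n : ℝ)| := by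
    rw [le_div_iff₀ hn']
    have := mul_le_mul_of_nonneg_left hb (show 0 ≤ 4 * Real.pi by positivity)
    refine le_trans (le_of_eq ?_) this
    field_simp
    ring
  rw [norm_pow, norm_norm]
  calc _ ≤ (4 * Real.pi * C / |(n : ℝ)|) ^ 2 := by gcongr
    _ = _ := by rw [div_pow, sq_abs]; ring

theorem continuous_char (k : Zd d) : Continuous (char k) := by
  unfold char
  fun_prop

theorem integral_fourier_two_pi (n : ℤ) :
    ∫ x : AddCircle (2 * Real.pi), fourier n x = if n = 0 then ((2 * Real.pi : ℝ) : ℂ) else 0 := by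
  split_ifs with h
  · subst h
    simp [Measure.real, AddCircle.measure_univ, Real.pi_pos.le]
  · exact integral_eq_zero_of_add_right_eq_neg
      (fourier_add_half_inv_index h (Fact.out : 0 < 2 * Real.pi))

theorem integral_char_mul_conj (k l : Zd d) :
    ∫ x : Td d, char k x * conj (char l x) =
      if k = l then (((2 * Real.pi) ^ d : ℝ) : ℂ) else 0 := by
  have h : ∀ x : Td d, char k x * conj (char l x) = ∏ i, fourier (k i - l i) (x i) := by
    intro x
    simp only [char, map_prod, ← Finset.prod_mul_distrib, ← fourier_neg, ← fourier_add,
      sub_eq_add_neg]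
  simp_rw [h]
  rw [integral_fintype_prod_volume_eq_prod
    (fun i (y : AddCircle (2 * Real.pi)) => fourier (k i - l i) y)]
  simp_rw [integral_fourier_two_pi]
  split_ifs with hkl
  · subst hkl
    simp
  · obtain ⟨i, hi⟩ := Function.ne_iff.mp hkl
    exact Finset.prod_eq_zero (Finset.mem_univ i) (by simp [sub_ne_zero.mpr hi])

/-- The function `ψ_k` as a continuous map on the torus. -/
def psi (k : Zd d) : C(Td d, ℂ) :=
  ⟨fun x => ((Real.sqrt ((2 * Real.pi) ^ d) : ℝ) : ℂ)⁻¹ * char k x,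
    continuous_const.mul (continuous_char k)⟩

/-- The class of a continuous function in `L²(𝕋^d)`. -/
abbrev toL2 (f : C(Td d, ℂ)) : Lp ℂ 2 (volume : Measure (Td d)) :=
  ContinuousMap.toLp 2 volume ℂ f

theorem orthonormal_psi : Orthonormal ℂ fun k : Zd d => toL2 (psi k) := by
  rw [orthonormal_iff_ite]
  intro k l
  rw [ContinuousMap.inner_toLp]
  have h : ∀ x : Td d, psi l x * conj (psi k x) =
      (((2 * Real.pi) ^ d : ℝ) : ℂ)⁻¹ * (char l x * conj (char k x)) := by
    intro x
    have hs : (((2 * Real.pi) ^ d : ℝ) : ℂ) =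
        ((Real.sqrt ((2 * Real.pi) ^ d) : ℝ) : ℂ) * ((Real.sqrt ((2 * Real.pi) ^ d) : ℝ) : ℂ) := by
      rw [← Complex.ofReal_mul, Real.mul_self_sqrt (by positivity)]
    simp only [psi, ContinuousMap.coe_mk, map_mul, map_inv₀, Complex.conj_ofReal]
    rw [hs, mul_inv]
    ring
  simp_rw [h]
  rw [integral_const_mul, integral_char_mul_conj]
  by_cases hkl : k = l
  · subst hkl
    have : (((2 * Real.pi) ^ d : ℝ) : ℂ) ≠ 0 := by
      exact_mod_cast (pow_pos Real.two_pi_pos d).ne'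
    simp only [if_true]
    exact inv_mul_cancel₀ this
  · simp [hkl, Ne.symm hkl]

theorem inner_psi {f : C(Td d, ℂ)} {a : Phase d → ℂ} {ξ : Rd d} (hf : ∀ x, f x = a (x, ξ))
    (k : Zd d) : inner ℂ (toL2 (psi k)) (toL2 f) = symbCoeff a k ξ := by
  rw [ContinuousMap.inner_toLp, symbCoeff, ← integral_const_mul]
  refine integral_congr_ae (Eventually.of_forall fun x => ?_)
  simp only [psi, ContinuousMap.coe_mk, map_mul, map_inv₀, Complex.conj_ofReal, hf]
  ring

theorem norm_toL2_sq (f : C(Td d, ℂ)) : ‖toL2 f‖ ^ 2 = ∫ x, ‖f x‖ ^ 2 := by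
  have h := inner_self_eq_norm_sq_to_K (𝕜 := ℂ) (toL2 f)
  rw [ContinuousMap.inner_toLp] at h
  have h' : ∀ x, f x * conj (f x) = ((‖f x‖ ^ 2 : ℝ) : ℂ) := fun x => by
    rw [Complex.mul_conj, Complex.normSq_eq_norm_sq]
  simp_rw [h'] at h
  rw [integral_complex_ofReal] at h
  exact Complex.ofReal_injective (by rw [Complex.ofReal_pow]; exact h.symm)

/-- Bessel's inequality for the nonzero Fourier modes of `a(·, ξ)`. -/
theorem bessel_symbCoeff {a : Phase d → ℂ} (ha : Continuous a) (ξ : Rd d) :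
    (Summable fun k : {k : Zd d // k ≠ 0} => ‖symbCoeff a k.1 ξ‖ ^ 2) ∧
    ∑' k : {k : Zd d // k ≠ 0}, ‖symbCoeff a k.1 ξ‖ ^ 2 ≤
      ∫ x : Td d,
        ‖a (x, ξ) - symbCoeff a 0 ξ * (((Real.sqrt ((2 * Real.pi) ^ d) : ℝ) : ℂ))⁻¹‖ ^ 2 := by
  let f : C(Td d, ℂ) := ⟨fun x => a (x, ξ), by fun_prop⟩
  let g : C(Td d, ℂ) := f - symbCoeff a 0 ξ • psi 0
  have hinner : ∀ k : Zd d, k ≠ 0 → inner ℂ (toL2 (psi k)) (toL2 g) = symbCoeff a k ξ := by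
    intro k hk
    simp only [g, map_sub, map_smul, inner_sub_right, inner_smul_right]
    rw [inner_psi (fun _ => rfl), (orthonormal_iff_ite.mp orthonormal_psi) k 0]
    simp [hk]
  have horth := (orthonormal_psi (d := d)).comp (Subtype.val : {k : Zd d // k ≠ 0} → Zd d)
    Subtype.val_injective
  have hg : ‖toL2 g‖ ^ 2 = ∫ x : Td d,
      ‖a (x, ξ) - symbCoeff a 0 ξ * (((Real.sqrt ((2 * Real.pi) ^ d) : ℝ) : ℂ))⁻¹‖ ^ 2 := by
    rw [norm_toL2_sq]
    simp [g, f, psi, char]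
  have hcoef : (fun k : {k : Zd d // k ≠ 0} => ‖symbCoeff a k.1 ξ‖ ^ 2) = fun k =>
      ‖(inner ℂ (((fun k : Zd d => toL2 (psi k)) ∘ Subtype.val) k) (toL2 g) : ℂ)‖ ^ 2 := by
    funext k
    rw [Function.comp_apply, hinner k.1 k.2]
  rw [hcoef, ← hg]
  exact ⟨horth.inner_products_summable _, horth.tsum_inner_products_le _⟩

theorem ResonantDir.M_pos (ω : ResonantDir d) : 0 < ω.M := by
  obtain ⟨i, hi⟩ := Function.ne_iff.mp ω.ne
  exact Finset.sum_pos' (fun j _ => mul_self_nonneg _)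
    ⟨i, Finset.mem_univ i, mul_self_pos.mpr hi⟩

theorem ResonantDir.ext_p {ω ω' : ResonantDir d} (h : ω.p = ω'.p) : ω = ω' := by
  cases ω
  cases ω'
  simpa using h

theorem ResonantDir.exists_first (ω : ResonantDir d) :
    ∃ i, (∀ j, j < i → ω.p j = 0) ∧ 0 < ω.p i := by
  obtain ⟨i, hi⟩ := Function.ne_iff.mp ω.ne
  obtain ⟨m, hm, hmin⟩ := WellFounded.has_min (wellFounded_lt (α := Fin d))
    {i | ω.p i ≠ 0} ⟨i, hi⟩
  have hz : ∀ j, j < m → ω.p j = 0 := fun j hj => by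
    by_contra h
    exact hmin j h hj
  exact ⟨m, hz, lt_of_le_of_ne (ω.first_pos m hz) (Ne.symm hm)⟩

/-- A nonzero lattice vector is a multiple of `p_ω` for at most one resonant direction `ω`,
with a unique coefficient. -/
theorem ResonantDir.smul_injective :
    Function.Injective fun q : ResonantDir d × {l : ℤ // l ≠ 0} => q.2.1 • q.1.p := by
  rintro ⟨ω, l, hl⟩ ⟨ω', l', hl'⟩ h
  have hc : ∀ i, l * ω.p i = l' * ω'.p i := fun i => by simpa using congrFun h i
  have hgcd : ∀ (η : ResonantDir d) (m : ℤ),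
      Finset.univ.gcd (fun i => (m * η.p i).natAbs) = m.natAbs := fun η m => by
    simp only [Int.natAbs_mul]
    rw [Finset.gcd_mul_left, η.gcd_one]
    simp
  have habs : l.natAbs = l'.natAbs := by
    rw [← hgcd ω l, ← hgcd ω' l']
    simp only [hc]
  have hll : l = l' := by
    rcases Int.natAbs_eq_natAbs_iff.mp habs with h1 | h1
    · exact h1
    · exfalso
      have hp : ∀ i, ω'.p i = -ω.p i := fun i => by
        have h2 := hc i
        rw [h1] at h2
        have : l' * (ω'.p i + ω.p i) = 0 := by linarith
        rcases mul_eq_zero.mp this with h3 | h3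
        · exact absurd h3 hl'
        · linarith
      obtain ⟨i, hz, hpos⟩ := ω.exists_first
      have := ω'.first_pos i fun j hj => by rw [hp, hz j hj, neg_zero]
      rw [hp] at this
      linarith
  subst hll
  have hω : ω = ω' := ResonantDir.ext_p (funext fun i => mul_left_cancel₀ hl (hc i))
  subst hω
  rfl

theorem kerKaphi_add_mul (a : Phase d → ℂ) (φ : ℝ → ℂ) (ω : ResonantDir d) (ξ : Rd d)
    {l : ℤ} (hl : l ≠ 0) (n : ℤ) :
    ‖kerKaphi a φ ω ξ (n + l * ω.M) n‖ ^ 2 = ((2 * Real.pi) ^ d)⁻¹ *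
      ‖phiHat φ (((-(l * (2 * n + l * ω.M)) : ℤ) : ℝ) / 2)‖ ^ 2 *
        ‖symbCoeff a (l • ω.p) ξ‖ ^ 2 := by
  have hM := ω.M_pos
  have h1 : n + l * ω.M ≠ n ∧ ω.M ∣ n + l * ω.M - n := by
    refine ⟨fun h => ?_, ⟨l, by ring⟩⟩
    have : l * ω.M = 0 := by linarith
    rcases mul_eq_zero.mp this with h | h
    · exact hl h
    · exact hM.ne' h
  have h2 : (n + l * ω.M - n) / ω.M = l := by
    rw [add_sub_cancel_left, Int.mul_ediv_cancel _ hM.ne']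
  have h3 : (((n ^ 2 - (n + l * ω.M) ^ 2 : ℤ) : ℝ) / (2 * (ω.M : ℝ))) =
      ((-(l * (2 * n + l * ω.M)) : ℤ) : ℝ) / 2 := by
    have : (ω.M : ℝ) ≠ 0 := by exact_mod_cast hM.ne'
    push_cast
    field_simp
    ring
  rw [kerKaphi, if_pos h1, h2, h3, norm_mul, norm_mul, mul_pow, mul_pow, norm_inv,
    Complex.norm_real, Real.norm_of_nonneg (Real.sqrt_nonneg _), inv_pow,
    Real.sq_sqrt (by positivity)]

/-- The Hilbert–Schmidt bound for a single resonant direction. -/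
theorem summable_kerKaphi {a : Phase d → ℂ} (ha : Continuous a) (φ : SchwartzMap ℝ ℂ)
    (ω : ResonantDir d) (ξ : Rd d) :
    (Summable fun q : ℤ × ℤ => ‖kerKaphi a (fun t => φ t) ω ξ q.1 q.2‖ ^ 2) ∧
    ∑' q : ℤ × ℤ, ‖kerKaphi a (fun t => φ t) ω ξ q.1 q.2‖ ^ 2 ≤
      ((2 * Real.pi) ^ d)⁻¹ * (∑' n : ℤ, ‖phiHat (fun t => φ t) ((n : ℝ) / 2)‖ ^ 2) *
        ∑' l : {l : ℤ // l ≠ 0}, ‖symbCoeff a (l.1 • ω.p) ξ‖ ^ 2 := by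
  set S := ∑' n : ℤ, ‖phiHat (fun t => φ t) ((n : ℝ) / 2)‖ ^ 2
  set F : ℤ × ℤ → ℝ := fun q => ‖kerKaphi a (fun t => φ t) ω ξ q.1 q.2‖ ^ 2 with hF
  have hM := ω.M_pos
  let e : {l : ℤ // l ≠ 0} × ℤ → ℤ × ℤ := fun q => (q.2 + q.1.1 * ω.M, q.2)
  have he : Function.Injective e := by
    rintro ⟨⟨l, hl⟩, n⟩ ⟨⟨l', hl'⟩, n'⟩ h
    simp only [e, Prod.mk.injEq] at h
    obtain ⟨h1, rfl⟩ := h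
    have : l = l' := mul_right_cancel₀ hM.ne' (add_left_cancel h1)
    subst this
    rfl
  have hsupp : Function.support F ⊆ Set.range e := by
    rintro ⟨m, n⟩ h
    have hc : m ≠ n ∧ ω.M ∣ (m - n) := by
      by_contra hc
      exact h (by simp [hF, kerKaphi, hc])
    obtain ⟨hmn, l, hl⟩ := hc
    refine ⟨(⟨l, ?_⟩, n), ?_⟩
    · rintro rfl
      exact hmn (by linarith)
    · simp only [e, Prod.mk.injEq, and_true]
      linarith
  have hj : ∀ l : {l : ℤ // l ≠ 0},
      Function.Injective fun n : ℤ => -(l.1 * (2 * n + l.1 * ω.M)) := fun l n n' h => by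
    have := mul_left_cancel₀ l.2 (neg_injective h)
    linarith
  have hφ := summable_phiHat_half φ
  have hFe : ∀ (l : {l : ℤ // l ≠ 0}) (n : ℤ), F (e (l, n)) =
      ((2 * Real.pi) ^ d)⁻¹ * ‖phiHat (fun t => φ t)
        (((-(l.1 * (2 * n + l.1 * ω.M)) : ℤ) : ℝ) / 2)‖ ^ 2 * ‖symbCoeff a (l.1 • ω.p) ξ‖ ^ 2 :=
    fun l n => kerKaphi_add_mul a _ ω ξ l.2 n
  have hrow : ∀ l : {l : ℤ // l ≠ 0}, Summable fun n => F (e (l, n)) := fun l => by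
    simp_rw [hFe]
    exact ((hφ.comp_injective (hj l)).mul_left _).mul_right _
  have hrow_le : ∀ l : {l : ℤ // l ≠ 0}, ∑' n, F (e (l, n)) ≤
      ((2 * Real.pi) ^ d)⁻¹ * S * ‖symbCoeff a (l.1 • ω.p) ξ‖ ^ 2 := fun l => by
    simp_rw [hFe]
    rw [tsum_mul_right, tsum_mul_left]
    gcongr
    exact tsum_comp_le_tsum_of_inj hφ (fun _ => by positivity) (hj l)
  have hmode : Summable fun l : {l : ℤ // l ≠ 0} => ‖symbCoeff a (l.1 • ω.p) ξ‖ ^ 2 := by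
    let E : {l : ℤ // l ≠ 0} → {k : Zd d // k ≠ 0} := fun l =>
      ⟨l.1 • ω.p, smul_ne_zero l.2 ω.ne⟩
    have hE : Function.Injective E := fun l l' h => by
      have h' : (ω, l) = (ω, l') := ResonantDir.smul_injective (congrArg Subtype.val h)
      exact congrArg Prod.snd h'
    have hs : Summable fun l => ‖symbCoeff a (E l).1 ξ‖ ^ 2 :=
      (bessel_symbCoeff ha ξ).1.comp_injective hE
    exact hs
  have hbound := hmode.mul_left (((2 * Real.pi) ^ d)⁻¹ * S)
  have hcols : Summable fun l : {l : ℤ // l ≠ 0} => ∑' n, F (e (l, n)) :=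
    hbound.of_nonneg_of_le (fun l => tsum_nonneg fun _ => by positivity) hrow_le
  have hcomp : Summable (F ∘ e) :=
    (summable_prod_of_nonneg fun _ => by simp only [hF, Function.comp]; positivity).mpr
      ⟨hrow, hcols⟩
  refine ⟨(he.summable_iff fun x hx => ?_).mp hcomp, ?_⟩
  · by_contra h
    exact hx (hsupp h)
  · calc ∑' q, F q = ∑' q, F (e q) := (he.tsum_eq hsupp).symm
      _ = ∑' l, ∑' n, F (e (l, n)) := hcomp.tsum_prod' hrow
      _ ≤ ∑' l : {l : ℤ // l ≠ 0}, ((2 * Real.pi) ^ d)⁻¹ * S * ‖symbCoeff a (l.1 • ω.p) ξ‖ ^ 2 :=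
        hcols.tsum_le_tsum hrow_le hbound
      _ = _ := tsum_mul_left

/-- Lemma 1: for a symbol `a ∈ C_c^∞(T^*𝕋^d)` (with Fourier
coefficients `symbCoeff a`) and `φ ∈ 𝒮(ℝ)`, each operator `k_{a,φ}(ω,ξ)` is
Hilbert–Schmidt on `L²(γ_ω)` and
`∑_{ω∈𝕎} ‖k_{a,φ}(ω,ξ)‖²_{HS}
   ≤ (2π)^{-d} (∑_{n∈ℤ} |φ̂(n/2)|²) ‖a(·,ξ) − a_0(ξ)ψ_0‖²_{L²(𝕋^d)}`. -/
theorem statement14 {d : ℕ} (a : Phase d → ℂ) (ha : IsSymbol a)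
    (φ : SchwartzMap ℝ ℂ) (ξ : Rd d) :
    (∀ ω : ResonantDir d, IsHSKer (kerKaphi a (fun t => φ t) ω ξ)) ∧
    (∑' ω : ResonantDir d, ∑' q : ℤ × ℤ, ‖kerKaphi a (fun t => φ t) ω ξ q.1 q.2‖ ^ 2)
      ≤ (((2 * Real.pi) ^ d : ℝ))⁻¹ *
          (∑' n : ℤ, ‖phiHat (fun t => φ t) ((n : ℝ) / 2)‖ ^ 2) *
          ∫ x : Td d,
            ‖a (x, ξ) - symbCoeff a 0 ξ * (((Real.sqrt ((2 * Real.pi) ^ d) : ℝ) : ℂ))⁻¹‖ ^ 2 := by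
  have hb := bessel_symbCoeff ha.1 ξ
  have hk := fun ω => summable_kerKaphi ha.1 φ ω ξ
  refine ⟨fun ω => (hk ω).1, ?_⟩
  set A := ((2 * Real.pi) ^ d : ℝ)⁻¹ * ∑' n : ℤ, ‖phiHat (fun t => φ t) ((n : ℝ) / 2)‖ ^ 2
  have hA0 : 0 ≤ A := mul_nonneg (by positivity) (tsum_nonneg fun _ => by positivity)
  let E : ResonantDir d × {l : ℤ // l ≠ 0} → {k : Zd d // k ≠ 0} := fun q =>
    ⟨q.2.1 • q.1.p, smul_ne_zero q.2.2 q.1.ne⟩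
  have hE : Function.Injective E := fun q q' h =>
    ResonantDir.smul_injective (congrArg Subtype.val h)
  have hs : Summable fun q => ‖symbCoeff a (E q).1 ξ‖ ^ 2 := hb.1.comp_injective hE
  have hle : ∑' q, ‖symbCoeff a (E q).1 ξ‖ ^ 2 ≤ _ :=
    (tsum_comp_le_tsum_of_inj hb.1 (fun _ => by positivity) hE).trans hb.2
  have hbound := hs.prod.mul_left A
  have hsum := hbound.of_nonneg_of_le (fun ω => tsum_nonneg fun _ => by positivity)
    fun ω => (hk ω).2
  refine (hsum.tsum_le_tsum (fun ω => (hk ω).2) hbound).trans ?_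
  rw [tsum_mul_left, ← hs.tsum_prod]
  exact mul_le_mul_of_nonneg_left hle hA0

end TorusSchrodinger
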